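/- Let X be a C^∞ vector field on an open set M ⊆ ℝ², and let m ∈ M with X(m) ≠ 0. Then there exists an open neighborhood U of m and a diffeomorphism φ : U → V onto an open set V ⊆ ℝ² such that the pushforward of X under φ is the constant coordinate vector field ∂/∂x₁; equivalently, Dφ(p)(X(p)) = (1, 0) for all p ∈ U (the flow-box / straightening theorem in dimension 2). -/

import Mathlib

open Set Filter Topology Metric
open scoped ContDiff unitInterval

universe u

section Superposition

variable {K : Type*} [TopologicalSpace K] [CompactSpace K]
variable {E F : Type*} [NormedAddCommGroup E] [NormedSpace ℝ E]
  [NormedAddCommGroup F] [NormedSpace ℝ F]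

/-- Constant functions, as a continuous linear map. -/
noncomputable def ContinuousMap.constCLM (K : Type*) [TopologicalSpace K] [CompactSpace K]
    (E : Type*) [NormedAddCommGroup E] [NormedSpace ℝ E] : E →L[ℝ] C(K, E) :=
  LinearMap.mkContinuous
    { toFun := ContinuousMap.const K
      map_add' := fun _ _ => rfl
      map_smul' := fun _ _ => rfl } 1 fun x => by
    rw [ContinuousMap.norm_le _ (by positivity), one_mul]
    exact fun _ => le_rfl

@[simp]
theorem ContinuousMap.constCLM_apply (x : E) (k : K) : ContinuousMap.constCLM K E x k = x := rfl

/-- Pointwise application of a continuous family of continuous linear maps. -/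
noncomputable def ContinuousMap.applyCLM (K : Type*) [TopologicalSpace K] [CompactSpace K]
    (E F : Type*) [NormedAddCommGroup E] [NormedSpace ℝ E]
    [NormedAddCommGroup F] [NormedSpace ℝ F] : C(K, E →L[ℝ] F) →L[ℝ] C(K, E) →L[ℝ] C(K, F) :=
  LinearMap.mkContinuous₂
    (LinearMap.mk₂ ℝ (fun (L : C(K, E →L[ℝ] F)) (h : C(K, E)) =>
        (⟨fun k => L k (h k), by fun_prop⟩ : C(K, F)))
      (fun _ _ _ => by ext; simp) (fun _ _ _ => by ext; simp)
      (fun _ _ _ => by ext; simp) (fun _ _ _ => by ext; simp)) 1 fun L h => by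
    rw [ContinuousMap.norm_le _ (by positivity)]
    intro k
    rw [one_mul]
    exact (L k).le_of_opNorm_le_of_le (L.norm_coe_le_norm k) (h.norm_coe_le_norm k)

theorem ContinuousMap.hasFDerivAt_comp (f : C(E, F)) (f' : C(E, E →L[ℝ] F))
    (hf : ∀ x, HasFDerivAt f (f' x) x) (α : C(K, E)) :
    HasFDerivAt (fun β : C(K, E) => f.comp β) (ContinuousMap.applyCLM K E F (f'.comp α)) α := by
  rw [hasFDerivAt_iff_isLittleO, Asymptotics.isLittleO_iff]
  intro ε hε
  have hcont : ContinuousAt (fun β : C(K, E) => f'.comp β) α :=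
    f'.continuous_postcomp.continuousAt
  obtain ⟨δ, hδ, H⟩ := Metric.eventually_nhds_iff.1
    (hcont (Metric.ball_mem_nhds (f'.comp α) hε))
  filter_upwards [Metric.ball_mem_nhds α hδ] with β hβ
  rw [ContinuousMap.norm_le _ (by positivity)]
  intro k
  have hk : β k ∈ ball (α k) δ := lt_of_le_of_lt (ContinuousMap.dist_apply_le_dist k) hβ
  have key := (convex_ball (α k) δ).norm_image_sub_le_of_norm_hasFDerivWithin_le'
    (f := f) (f' := f') (φ := f' (α k)) (C := ε)
    (fun y _ => (hf y).hasFDerivWithinAt) (fun y hy => ?_) (mem_ball_self hδ) hk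
  · refine key.trans ?_
    gcongr
    exact (β - α).norm_coe_le_norm k
  · have hmem : dist (α + ContinuousMap.constCLM K E (y - α k)) α < δ := by
      rw [dist_eq_norm, add_sub_cancel_left]
      refine lt_of_le_of_lt ?_ (mem_ball_iff_norm.1 hy)
      rw [ContinuousMap.norm_le _ (by positivity)]
      simp
    have h2 := lt_of_le_of_lt (ContinuousMap.dist_apply_le_dist k) (mem_ball.1 (H hmem))
    rw [dist_eq_norm] at h2
    simpa using h2.le

end Superposition

theorem ContinuousMap.contDiff_comp {K : Type*} [TopologicalSpace K] [CompactSpace K] {E : Type u}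
    [NormedAddCommGroup E] [NormedSpace ℝ E] (n : ℕ) {F : Type u} [NormedAddCommGroup F]
    [NormedSpace ℝ F] (f : C(E, F)) (hf : ContDiff ℝ n f) :
    ContDiff ℝ n (fun α : C(K, E) => f.comp α) := by
  induction n generalizing F with
  | zero => exact contDiff_zero.2 f.continuous_postcomp
  | succ n ih =>
    push_cast at hf ⊢
    obtain ⟨f', hf', hd⟩ := contDiff_succ_iff_hasFDerivAt.1 hf
    rw [contDiff_succ_iff_hasFDerivAt]
    exact ⟨_, (ContinuousMap.applyCLM K E F).contDiff.comp (ih ⟨f', hf'.continuous⟩ hf'),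
      ContinuousMap.hasFDerivAt_comp f ⟨f', hf'.continuous⟩ hd⟩

/-- Inverse function theorem for smooth maps, with a local inverse smooth on its whole domain. -/
theorem exists_openPartialHomeomorph_contDiffOn_symm {E F : Type*} [NormedAddCommGroup E]
    [NormedSpace ℝ E] [CompleteSpace E] [NormedAddCommGroup F] [NormedSpace ℝ F]
    {f : E → F} {s : Set E} (hs : IsOpen s) (hf : ContDiffOn ℝ ∞ f s) {a : E} (ha : a ∈ s)
    (f' : E ≃L[ℝ] F) (hf' : HasFDerivAt f (f' : E →L[ℝ] F) a) :
    ∃ e : OpenPartialHomeomorph E F, ⇑e = f ∧ a ∈ e.source ∧ e.source ⊆ s ∧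
      ContDiffOn ℝ ∞ e.symm e.target := by
  have hfa : ContDiffAt ℝ ∞ f a := hf.contDiffAt (hs.mem_nhds ha)
  let e₀ := hfa.toOpenPartialHomeomorph f hf' (by simp)
  have ho : IsOpen (s ∩ fderiv ℝ f ⁻¹' range ((↑) : (E ≃L[ℝ] F) → E →L[ℝ] F)) :=
    (hf.continuousOn_fderiv_of_isOpen hs (by simp)).isOpen_inter_preimage hs
      ContinuousLinearEquiv.isOpen
  refine ⟨e₀.restrOpen _ ho, rfl, ?_, ?_, ?_⟩
  · exact ⟨hfa.mem_toOpenPartialHomeomorph_source hf' (by simp), ha, f', hf'.fderiv.symm⟩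
  · exact fun x hx => hx.2.1
  · intro y hy
    obtain ⟨-, hys, g, hg⟩ := (e₀.restrOpen _ ho).map_target hy
    have hc := hf.contDiffAt (hs.mem_nhds hys)
    refine ((e₀.restrOpen _ ho).contDiffAt_symm (f₀' := g) hy ?_ hc).contDiffWithinAt
    rw [hg]
    exact (hc.differentiableAt (by simp)).hasFDerivAt

/-- The primitive vanishing at `0`, as an operator on continuous functions on `[0, 1]`. -/
noncomputable def unitInterval.primitiveCLM (E : Type*) [NormedAddCommGroup E] [NormedSpace ℝ E] :
    C(I, E) →L[ℝ] C(I, E) :=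
  LinearMap.mkContinuous
    { toFun := fun f => ⟨fun s => ∫ u in (0 : ℝ)..s, IccExtend zero_le_one f u,
        (intervalIntegral.continuous_primitive
          (fun a b => (f.continuous.Icc_extend' ).intervalIntegrable a b) 0).comp
          continuous_subtype_val⟩
      map_add' := fun f g => by
        ext s
        exact intervalIntegral.integral_add ((f.continuous.Icc_extend').intervalIntegrable _ _)
          ((g.continuous.Icc_extend').intervalIntegrable _ _)
      map_smul' := fun c f => by
        ext s
        exact intervalIntegral.integral_smul c _ } 1 fun f => by
    rw [ContinuousMap.norm_le _ (by positivity)]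
    intro s
    refine (intervalIntegral.norm_integral_le_of_norm_le_const (C := ‖f‖)
      fun u _ => f.norm_coe_le_norm _).trans ?_
    rw [sub_zero, abs_of_nonneg s.2.1, one_mul]
    exact mul_le_of_le_one_right (norm_nonneg _) s.2.2

theorem unitInterval.primitiveCLM_apply {E : Type*} [NormedAddCommGroup E] [NormedSpace ℝ E]
    (f : C(I, E)) (s : I) :
    unitInterval.primitiveCLM E f s = ∫ u in (0 : ℝ)..s, IccExtend zero_le_one f u := rfl

section Flow

open unitInterval (primitiveCLM primitiveCLM_apply)
open ContinuousMap (constCLM constCLM_apply)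

/-- Rescaling time in an integral curve of `t • X` gives an integral curve of `(t * s) • X`. -/
theorem comp_mul_eq_const_add_primitive {E : Type*} [NormedAddCommGroup E] [NormedSpace ℝ E]
    (X : C(E, E)) (x : E) (t : ℝ) (α : C(I, E))
    (h : α = constCLM I E x + t • primitiveCLM E (X.comp α)) (s : I) :
    α.comp ⟨fun r => s * r, by fun_prop⟩ = constCLM I E x +
      (t * s) • primitiveCLM E (X.comp (α.comp ⟨fun r => s * r, by fun_prop⟩)) := by
  ext r
  have h1 := congrArg (fun β : C(I, E) => β (s * r)) h
  simp only [ContinuousMap.add_apply, ContinuousMap.smul_apply, constCLM_apply,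
    primitiveCLM_apply] at h1
  simp only [ContinuousMap.comp_apply, ContinuousMap.coe_mk, ContinuousMap.add_apply,
    ContinuousMap.smul_apply, constCLM_apply, primitiveCLM_apply]
  rw [h1, mul_smul, Set.Icc.coe_mul]
  have h2 := intervalIntegral.smul_integral_comp_mul_left (a := 0) (b := (r : ℝ))
    (IccExtend zero_le_one (X.comp α)) (s : ℝ)
  rw [mul_zero] at h2
  rw [← h2]
  congr 3
  refine intervalIntegral.integral_congr fun u hu => ?_
  rw [uIcc_of_le r.2.1] at hu
  have hu1 : u ∈ Icc (0 : ℝ) 1 := ⟨hu.1, hu.2.trans r.2.2⟩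
  have hsu : (s : ℝ) * u ∈ Icc (0 : ℝ) 1 := unitInterval.mul_mem s.2 hu1
  simp only [IccExtend_of_mem zero_le_one _ hsu, IccExtend_of_mem zero_le_one _ hu1]
  rfl

/-- A smooth vector field has a local flow depending smoothly on time and initial point. -/
theorem exists_contDiffOn_flow {E : Type u} [NormedAddCommGroup E] [NormedSpace ℝ E]
    [CompleteSpace E] (X : E → E) (hX : ContDiff ℝ ∞ X) (m : E) :
    ∃ (W : Set (ℝ × E)) (Φ : ℝ × E → E), IsOpen W ∧ (0, m) ∈ W ∧ ContDiffOn ℝ ∞ Φ W ∧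
      (∀ x, (0, x) ∈ W → Φ (0, x) = x) ∧
      ∀ q ∈ W, HasDerivAt (fun t => Φ (t, q.2)) (X (Φ q)) q.1 := by
  let X' : C(E, E) := ⟨X, hX.continuous⟩
  have hN : ContDiff ℝ ∞ (fun α : C(I, E) => X'.comp α) :=
    contDiff_infty.2 fun n => ContinuousMap.contDiff_comp n X' (contDiff_infty.1 hX n)
  let R : (ℝ × E) × C(I, E) → C(I, E) := fun p =>
    p.2 - constCLM I E p.1.2 - p.1.1 • primitiveCLM E (X'.comp p.2)
  let Ψ : (ℝ × E) × C(I, E) → (ℝ × E) × C(I, E) := fun p => (p.1, R p)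
  have hNp : ContDiff ℝ ∞ (fun p : (ℝ × E) × C(I, E) => primitiveCLM E (X'.comp p.2)) :=
    (primitiveCLM E).contDiff.comp (hN.comp contDiff_snd)
  have hΨ : ContDiff ℝ ∞ Ψ :=
    contDiff_fst.prodMk ((contDiff_snd.sub
      ((constCLM I E).contDiff.comp (contDiff_snd.comp contDiff_fst))).sub
      ((contDiff_fst.comp contDiff_fst).smul hNp))
  let b : (ℝ × E) × C(I, E) := ((0, m), constCLM I E m)
  let v := primitiveCLM E (X'.comp (constCLM I E m))
  let L : ℝ × E →L[ℝ] C(I, E) := -((constCLM I E).comp (.snd ℝ ℝ E)) -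
    (ContinuousLinearMap.fst ℝ ℝ E).smulRight v
  let Ψ' := ContinuousLinearEquiv.skewProd (.refl ℝ (ℝ × E)) (.refl ℝ C(I, E)) L
  have hΨ' : HasFDerivAt Ψ (Ψ' : _ →L[ℝ] _) b := by
    have h1 : HasFDerivAt (fun p : (ℝ × E) × C(I, E) => p.1.1)
        ((ContinuousLinearMap.fst ℝ ℝ E).comp (.fst ℝ (ℝ × E) C(I, E))) b :=
      ((ContinuousLinearMap.fst ℝ ℝ E).comp (.fst ℝ (ℝ × E) C(I, E))).hasFDerivAt
    have h2 : HasFDerivAt (fun p : (ℝ × E) × C(I, E) => constCLM I E p.1.2)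
        ((constCLM I E).comp ((ContinuousLinearMap.snd ℝ ℝ E).comp
          (.fst ℝ (ℝ × E) C(I, E)))) b :=
      ((constCLM I E).comp ((ContinuousLinearMap.snd ℝ ℝ E).comp
          (.fst ℝ (ℝ × E) C(I, E)))).hasFDerivAt
    have h3 := h1.smul (hNp.differentiable (by simp) b).hasFDerivAt
    refine (hasFDerivAt_fst.prodMk ((hasFDerivAt_snd.sub h2).sub h3)).congr_fderiv ?_
    refine ContinuousLinearMap.ext fun p => Prod.ext rfl ?_
    simp [Ψ', L, b, v]
    abel
  obtain ⟨e, he, hb, -, hes⟩ := exists_openPartialHomeomorph_contDiffOn_symm isOpen_univ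
    hΨ.contDiffOn (mem_univ b) Ψ' hΨ'
  have hR : ∀ p : (ℝ × E) × C(I, E), R p = 0 ↔
      p.2 = constCLM I E p.1.2 + p.1.1 • primitiveCLM E (X'.comp p.2) := fun p => by
    rw [← sub_eq_zero (b := _ + _), ← sub_sub]
  let α : ℝ × E → C(I, E) := fun q => (e.symm (q, 0)).2
  let W₀ : Set (ℝ × E) := {q | (q, 0) ∈ e.target}
  have hι : ContDiff ℝ ∞ (fun q : ℝ × E => (q, (0 : C(I, E)))) :=
    contDiff_id.prodMk contDiff_const
  have hW₀ : IsOpen W₀ := e.open_target.preimage hι.continuous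
  have hα : ContDiffOn ℝ ∞ α W₀ :=
    contDiff_snd.comp_contDiffOn (hes.comp hι.contDiffOn fun q hq => hq)
  have hsol : ∀ q ∈ W₀, α q = constCLM I E q.2 + q.1 • primitiveCLM E (X'.comp (α q)) := by
    intro q hq
    have h1 : Ψ (e.symm (q, 0)) = (q, 0) := by rw [← he]; exact e.right_inv hq
    have h2 : (e.symm (q, 0)).1 = q := congrArg Prod.fst h1
    have h3 := (hR _).1 (congrArg Prod.snd h1)
    rwa [h2] at h3
  have huniq : ∀ p ∈ e.source,
      p.2 = constCLM I E p.1.2 + p.1.1 • primitiveCLM E (X'.comp p.2) →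
      p.1 ∈ W₀ ∧ α p.1 = p.2 := by
    intro p hp h
    have h1 : e p = (p.1, 0) := by rw [he]; exact Prod.ext rfl ((hR p).2 h)
    refine ⟨?_, ?_⟩
    · change (p.1, 0) ∈ e.target
      rw [← h1]
      exact e.map_source hp
    · change (e.symm (p.1, 0)).2 = p.2
      rw [← h1, e.left_inv hp]
  obtain ⟨δ, hδ, hball⟩ := Metric.isOpen_iff.1 e.open_source b hb
  let W : Set (ℝ × E) := W₀ ∩ (fun q => (q, α q)) ⁻¹' ball b δ
  have hW : IsOpen W :=
    (continuousOn_id.prodMk hα.continuousOn).isOpen_inter_preimage hW₀ isOpen_ball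
  have hscale : ∀ q ∈ W, ∀ s : I, (q.1 * s, q.2) ∈ W ∧ α (q.1 * s, q.2) 1 = α q s := by
    rintro ⟨t, x⟩ ⟨hq, hqb⟩ s
    let β : C(I, E) := (α (t, x)).comp ⟨fun r => s * r, by fun_prop⟩
    have hβ : β = constCLM I E x + (t * s) • primitiveCLM E (X'.comp β) :=
      comp_mul_eq_const_add_primitive X' x t _ (hsol _ hq) s
    have hmem : ((t * s, x), β) ∈ ball b δ := by
      simp only [mem_preimage, mem_ball, Prod.dist_eq, max_lt_iff, b] at hqb ⊢
      obtain ⟨⟨ht, hx⟩, ha⟩ := hqb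
      refine ⟨⟨lt_of_le_of_lt ?_ ht, hx⟩, lt_of_le_of_lt ?_ ha⟩
      · rw [dist_zero_right, dist_zero_right, norm_mul]
        refine mul_le_of_le_one_right (norm_nonneg _) ?_
        rw [Real.norm_of_nonneg s.2.1]
        exact s.2.2
      · rw [ContinuousMap.dist_le dist_nonneg]
        exact fun r => (ContinuousMap.dist_apply_le_dist (f := α (t, x))
          (g := constCLM I E m) (s * r))
    obtain ⟨h1, h2⟩ := huniq _ (hball hmem) hβ
    refine ⟨⟨h1, ?_⟩, ?_⟩
    · change ((t * s, x), α (t * s, x)) ∈ ball b δ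
      rw [show α (t * s, x) = β from h2]
      exact hmem
    · rw [show α (t * s, x) = β from h2]
      change α (t, x) (s * 1) = _
      rw [mul_one]
  let Φ : ℝ × E → E := fun q => α q 1
  have hΦ : ContDiffOn ℝ ∞ Φ W :=
    (ContinuousMap.evalCLM ℝ (1 : I) : C(I, E) →L[ℝ] E).contDiff.comp_contDiffOn (hα.mono inter_subset_left)
  have hint : ∀ q ∈ W, Φ q = q.2 + ∫ u in (0 : ℝ)..q.1, X (Φ (u, q.2)) := by
    intro q hq
    have h1 := congrArg (fun β : C(I, E) => β 1) (hsol q hq.1)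
    simp only [ContinuousMap.add_apply, ContinuousMap.smul_apply, constCLM_apply,
      primitiveCLM_apply] at h1
    have h2 := intervalIntegral.smul_integral_comp_mul_left (a := 0) (b := 1)
      (fun u => X (Φ (u, q.2))) q.1
    rw [mul_zero, mul_one] at h2
    change α q 1 = _
    rw [h1, ← h2]
    congr 2
    refine intervalIntegral.integral_congr fun u hu => ?_
    rw [Set.Icc.coe_one, uIcc_of_le zero_le_one] at hu
    simp only [IccExtend_of_mem zero_le_one _ hu]
    exact congrArg X (hscale q hq ⟨u, hu⟩).2.symm
  refine ⟨W, Φ, hW, ?_, hΦ, ?_, ?_⟩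
  · have h := huniq b hb (by simp [b])
    refine ⟨h.1, ?_⟩
    change ((0, m), α (0, m)) ∈ ball b δ
    rw [show α (0, m) = _ from h.2]
    exact mem_ball_self hδ
  · intro x hx
    simpa using hint _ hx
  · rintro ⟨t, x⟩ hq
    have ho : IsOpen {u : ℝ | (u, x) ∈ W} := hW.preimage (by fun_prop)
    have hc : ContinuousOn (fun u => X (Φ (u, x))) {u : ℝ | (u, x) ∈ W} :=
      hX.continuous.comp_continuousOn (hΦ.continuousOn.comp (by fun_prop) fun u hu => hu)
    have hsub : uIcc 0 t ⊆ {u : ℝ | (u, x) ∈ W} := by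
      have := image_const_mul_uIcc t 0 1
      rw [mul_zero, mul_one] at this
      rw [← this, uIcc_of_le zero_le_one]
      rintro _ ⟨u, hu, rfl⟩
      exact (hscale _ hq ⟨u, hu⟩).1
    have hd := (intervalIntegral.integral_hasDerivAt_right (hc.mono hsub).intervalIntegrable
      (hc.stronglyMeasurableAtFilter ho t hq) (hc.continuousAt (ho.mem_nhds hq))).const_add x
    refine hd.congr_of_eventuallyEq ?_
    filter_upwards [ho.mem_nhds hq] with u hu
    exact hint _ hu

end Flow

/-- A map smooth on an open set agrees near any of its points with a globally smooth map. -/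
theorem ContDiffOn.exists_contDiff_eqOn {E F : Type*} [NormedAddCommGroup E] [NormedSpace ℝ E]
    [FiniteDimensional ℝ E] [NormedAddCommGroup F] [NormedSpace ℝ F] {f : E → F} {s : Set E}
    (hf : ContDiffOn ℝ ∞ f s) (hs : IsOpen s) {x : E} (hx : x ∈ s) :
    ∃ (g : E → F) (u : Set E), ContDiff ℝ ∞ g ∧ IsOpen u ∧ x ∈ u ∧ u ⊆ s ∧ EqOn g f u := by
  obtain ⟨r, hr, hrs⟩ := Metric.nhds_basis_closedBall.mem_iff.1 (hs.mem_nhds hx)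
  let χ : ContDiffBump x := ⟨r / 2, r, by positivity, by linarith⟩
  refine ⟨fun y => χ y • f y, ball x (r / 2), ?_, isOpen_ball, mem_ball_self (by positivity),
    (ball_subset_closedBall.trans (closedBall_subset_closedBall (by linarith))).trans hrs, ?_⟩
  · rw [contDiff_iff_contDiffAt]
    intro y
    by_cases hy : y ∈ tsupport χ
    · rw [χ.tsupport_eq] at hy
      exact χ.contDiff.contDiffAt.smul (hf.contDiffAt (hs.mem_nhds (hrs hy)))
    · refine (contDiffAt_const (c := (0 : F))).congr_of_eventuallyEq ?_
      filter_upwards [notMem_tsupport_iff_eventuallyEq.1 hy] with z hz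
      simp [hz]
  · intro y hy
    simp [χ.one_of_mem_closedBall (ball_subset_closedBall hy)]

/-- The linear map `(t, a) ↦ t • v + a • v⊥` of the plane is invertible for `v ≠ 0`. -/
theorem exists_continuousLinearEquiv_frame (v : ℝ × ℝ) (hv : v ≠ 0) :
    ∃ L : (ℝ × ℝ) ≃L[ℝ] ℝ × ℝ, L (1, 0) = v ∧ L (0, 1) = (-v.2, v.1) := by
  let f : ℝ × ℝ →ₗ[ℝ] ℝ × ℝ := (LinearMap.fst ℝ ℝ ℝ).smulRight v +
    (LinearMap.snd ℝ ℝ ℝ).smulRight (-v.2, v.1)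
  have hinj : Function.Injective f := by
    rw [injective_iff_map_eq_zero]
    rintro ⟨s, a⟩ h
    have h1 : s * v.1 + a * -v.2 = 0 := congrArg Prod.fst h
    have h2 : s * v.2 + a * v.1 = 0 := congrArg Prod.snd h
    have hn : v.1 ^ 2 + v.2 ^ 2 ≠ 0 := by
      intro h0
      refine hv (Prod.ext ?_ ?_)
      · exact pow_eq_zero_iff two_ne_zero |>.1 (by nlinarith [sq_nonneg v.1, sq_nonneg v.2])
      · exact pow_eq_zero_iff two_ne_zero |>.1 (by nlinarith [sq_nonneg v.1, sq_nonneg v.2])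
    have hs : s = 0 := (mul_eq_zero_iff_right hn).1 (by linear_combination v.1 * h1 + v.2 * h2)
    have ha : a = 0 := (mul_eq_zero_iff_right hn).1 (by linear_combination v.1 * h2 - v.2 * h1)
    rw [hs, ha]
    rfl
  refine ⟨(LinearEquiv.ofInjectiveEndo f hinj).toContinuousLinearEquiv, ?_, ?_⟩
  · change f (1, 0) = v
    simp [f]
  · change f (0, 1) = _
    simp [f]

/-- Flow-box / straightening theorem in dimension 2: if `X` is a smooth vector
field on an open set `M ⊆ ℝ²` and `X m ≠ 0`, then there is a diffeomorphism
`φ` of a neighborhood `U` of `m` onto an open set `V` whose differential sends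
`X` to the constant vector field `∂/∂x₁ = (1,0)`. -/
theorem stmt_10 (M : Set (ℝ × ℝ)) (hM : IsOpen M)
    (X : ℝ × ℝ → ℝ × ℝ) (hX : ContDiffOn ℝ (⊤ : ℕ∞) X M)
    (m : ℝ × ℝ) (hm : m ∈ M) (hXm : X m ≠ 0) :
    ∃ (U V : Set (ℝ × ℝ)) (φ ψ : ℝ × ℝ → ℝ × ℝ),
      IsOpen U ∧ m ∈ U ∧ U ⊆ M ∧ IsOpen V ∧
      ContDiffOn ℝ (⊤ : ℕ∞) φ U ∧ ContDiffOn ℝ (⊤ : ℕ∞) ψ V ∧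
      Set.BijOn φ U V ∧ Set.LeftInvOn ψ φ U ∧
      ∀ p ∈ U, fderiv ℝ φ p (X p) = (1, 0) := by
  obtain ⟨Y, N, hY, hN, hmN, hNM, hYX⟩ := hX.exists_contDiff_eqOn hM hm
  obtain ⟨W, Φ, hW, hmW, hΦ, hΦ0, hΦt⟩ := exists_contDiffOn_flow Y hY m
  obtain ⟨L, hL1, hL2⟩ := exists_continuousLinearEquiv_frame (X m) hXm
  let w : ℝ × ℝ := (-(X m).2, (X m).1)
  let ι : ℝ × ℝ → ℝ × ℝ × ℝ := fun q => (q.1, m + q.2 • w)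
  have hι : ContDiff ℝ ∞ ι :=
    contDiff_fst.prodMk (contDiff_const.add (contDiff_snd.smul contDiff_const))
  have hι0 : ι 0 = (0, m) := by simp [ι]
  let Θ : ℝ × ℝ → ℝ × ℝ := Φ ∘ ι
  have hΘ0 : Θ 0 = m := by
    change Φ (ι 0) = m
    rw [hι0, hΦ0 m hmW]
  have hWo : IsOpen (ι ⁻¹' W) := hW.preimage hι.continuous
  have hΘ : ContDiffOn ℝ ∞ Θ (ι ⁻¹' W) := hΦ.comp hι.contDiffOn fun q hq => hq
  let s : Set (ℝ × ℝ) := ι ⁻¹' W ∩ Θ ⁻¹' N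
  have hs : IsOpen s := hΘ.continuousOn.isOpen_inter_preimage hWo hN
  have h0W : (0 : ℝ × ℝ) ∈ ι ⁻¹' W := by
    rw [mem_preimage, hι0]
    exact hmW
  have h0s : (0 : ℝ × ℝ) ∈ s := ⟨h0W, by rw [mem_preimage, hΘ0]; exact hmN⟩
  have hdiff : ∀ q ∈ s, HasFDerivAt Θ (fderiv ℝ Θ q) q := fun q hq =>
    ((hΘ.contDiffAt (hWo.mem_nhds hq.1)).differentiableAt (by simp)).hasFDerivAt
  have hfst : ∀ q ∈ s, fderiv ℝ Θ q (1, 0) = X (Θ q) := by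
    intro q hq
    have h1 : HasDerivAt (fun t : ℝ => (t, q.2)) (1, 0) q.1 :=
      (hasDerivAt_id q.1).prodMk (hasDerivAt_const q.1 q.2)
    have h2 := (hdiff q hq).comp_hasDerivAt q.1 h1
    rw [← hYX hq.2]
    exact h2.unique (hΦt (ι q) hq.1)
  have hsnd : fderiv ℝ Θ 0 (0, 1) = w := by
    have h1 : HasDerivAt (fun a : ℝ => ((0 : ℝ), a)) (0, 1) 0 :=
      (hasDerivAt_const 0 (0 : ℝ)).prodMk (hasDerivAt_id 0)
    have h2 := (hdiff 0 h0s).comp_hasDerivAt (0 : ℝ) h1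
    have h3 : HasDerivAt (fun a : ℝ => m + a • w) w 0 := by
      simpa using ((hasDerivAt_id (0 : ℝ)).smul_const w).const_add m
    refine h2.unique (h3.congr_of_eventuallyEq ?_)
    filter_upwards [(hWo.preimage (f := fun a : ℝ => ((0 : ℝ), a)) (by fun_prop)).mem_nhds h0W]
      with a ha
    exact hΦ0 _ ha
  have hL : fderiv ℝ Θ 0 = L := by
    ext : 1
    · ext : 1
      change fderiv ℝ Θ 0 (1, 0) = L (1, 0)
      rw [hfst 0 h0s, hΘ0, hL1]
    · ext : 1
      change fderiv ℝ Θ 0 (0, 1) = L (0, 1)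
      rw [hsnd, hL2]
  obtain ⟨e, he, h0e, hes, hsymm⟩ := exists_openPartialHomeomorph_contDiffOn_symm hs
    (hΘ.mono inter_subset_left) h0s L (hL ▸ hdiff 0 h0s)
  have hesymm : ∀ p ∈ e.target, Θ (e.symm p) = p := fun p hp => by
    rw [← he]
    exact e.right_inv hp
  refine ⟨e.target, e.source, e.symm, e, e.open_target, ?_, ?_, e.open_source, hsymm, ?_,
    e.symm.bijOn, fun p hp => e.right_inv hp, ?_⟩
  · have := e.map_source h0e
    rwa [he, hΘ0] at this
  · intro p hp
    rw [← hesymm p hp]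
    exact hNM (hes (e.map_target hp)).2
  · rw [he]
    exact hΘ.mono (hes.trans inter_subset_left)
  · intro p hp
    have hq := e.map_target hp
    set q := e.symm p with hqdef
    have hqp : Θ q = p := hesymm p hp
    have h1 : HasFDerivAt e.symm (fderiv ℝ e.symm p) (Θ q) := by
      rw [hqp]
      exact ((hsymm.contDiffAt (e.open_target.mem_nhds hp)).differentiableAt
        (by simp)).hasFDerivAt
    have h2 := h1.comp q (hdiff q (hes hq))
    have h3 : HasFDerivAt (e.symm ∘ Θ) (ContinuousLinearMap.id ℝ (ℝ × ℝ)) q := by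
      refine (hasFDerivAt_id q).congr_of_eventuallyEq ?_
      filter_upwards [e.open_source.mem_nhds hq] with z hz
      rw [← he]
      exact e.left_inv hz
    have h4 := DFunLike.congr_fun (h2.unique h3) (1, 0)
    rwa [ContinuousLinearMap.comp_apply, hfst q (hes hq), hqp] at h4
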